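/- Fix Q ≥ 2, K ≥ 1 and T ≥ 3. Let θ = (β, γ, λ) with λ_1 < … < λ_{Q−1}, let y_0 ∈ {1,…,Q}, x = (x_1,…,x_T) ∈ (ℝ^K)^T, and for a path y ∈ {1,…,Q}^T write z_u = z(y_{u−1}, x_u, θ) for u ∈ {1,…,T} (with y_0 the initial outcome). For q_1, q_3 ∈ {1,…,Q−1} and time indices t, s, r with 1 ≤ t < s < r ≤ T, define m^{(t,s,r)}_{y_0,q_1,Q,q_3}(y, x, θ) casewise by: exp(z_t − z_s + λ_{Q−1,q_1}) if y_t ≤ q_1, y_s = Q, y_r ≤ q_3; exp(z_t − z_r + λ_{q_3,q_1}) if y_t ≤ q_1, y_s = Q, y_r > q_3; −1 if y_t > q_1, y_s < Q; exp(z_r − z_s + λ_{Q−1,q_3}) − 1 if y_t > q_1, y_s = Q, y_r ≤ q_3; and 0 otherwise. Then for every weight function w : {1,…,Q}^{t−1} → ℝ and every α ∈ ℝ: Σ_{y ∈ {1,…,Q}^T} w(y_1,…,y_{t−1}) · m^{(t,s,r)}_{y_0,q_1,Q,q_3}(y, x, θ) · p_{y_0}(y, x, θ, α) = 0. -/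

import Mathlib

open Finset

/-- The logistic CDF `Λ(u) = 1/(1+exp(-u))`. -/
noncomputable def Lam (u : ℝ) : ℝ := 1 / (1 + Real.exp (-u))

/-- Probability that an ordered logit outcome with index `ζ` and thresholds
`lam` (categories `1,…,Q`, with the conventions `λ_0 = -∞`, `λ_Q = +∞`) equals `q`. -/
noncomputable def catProb (Q : ℕ) (lam : ℕ → ℝ) (ζ : ℝ) (q : ℕ) : ℝ :=
  (if q = 1 then 1 else Lam (ζ - lam (q - 1))) - (if q = Q then 0 else Lam (ζ - lam q))

/-- The full outcome path `u ↦ y_u` on `{0,1,…,T}`, with initial outcome `y_0` and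
post-initial outcomes `y = (y_1,…,y_T)`. -/
def fullPath (T y0 : ℕ) (y : Fin T → ℕ) : ℕ → ℕ :=
  fun u => if h : 1 ≤ u ∧ u ≤ T then y ⟨u - 1, by omega⟩ else y0

/-- The single index `z_u = x_u′β + γ_{y_{u-1}}` for a path `p`. -/
noncomputable def zidx {K : ℕ} (β : Fin K → ℝ) (γ : ℕ → ℝ)
    (x : ℕ → Fin K → ℝ) (p : ℕ → ℕ) (u : ℕ) : ℝ :=
  (∑ k, x u k * β k) + γ (p (u - 1))

/-- Model probability `p_{y_0}(y, x, θ, α)` of a full outcome path `p : ℕ → ℕ`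
(with `p 0` the initial outcome). -/
noncomputable def pathProb (Q T : ℕ) {K : ℕ} (β : Fin K → ℝ) (γ lam : ℕ → ℝ)
    (x : ℕ → Fin K → ℝ) (α : ℝ) (p : ℕ → ℕ) : ℝ :=
  ∏ u ∈ Finset.Icc 1 T, catProb Q lam (zidx β γ x p u + α) (p u)

/-- Iterated conditional expectation over periods `u, …, u+n-1` with kernel `f`. -/
noncomputable def Ex (Q : ℕ) (f : ℕ → ℕ → ℕ → ℝ) :
    ℕ → ℕ → ((ℕ → ℕ) → ℝ) → (ℕ → ℕ) → ℝ
  | _, 0, G, p => G p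
  | u, n + 1, G, p =>
      ∑ q ∈ Finset.Icc 1 Q, f u (p (u - 1)) q * Ex Q f (u + 1) n G (Function.update p u q)

lemma Ex_one (Q : ℕ) (f : ℕ → ℕ → ℕ → ℝ) (u : ℕ) (G : (ℕ → ℕ) → ℝ) (p : ℕ → ℕ) :
    Ex Q f u 1 G p = ∑ q ∈ Finset.Icc 1 Q, f u (p (u - 1)) q * G (Function.update p u q) := by
  simp [Ex]

lemma Ex_add (Q : ℕ) (f : ℕ → ℕ → ℕ → ℝ) (m n : ℕ) (G : (ℕ → ℕ) → ℝ) :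
    ∀ (u : ℕ) (p : ℕ → ℕ), Ex Q f u (m + n) G p = Ex Q f u m (Ex Q f (u + m) n G) p := by
  induction m with
  | zero => intro u p; simp [Ex]
  | succ m ih =>
    intro u p
    have e : m + 1 + n = (m + n) + 1 := by omega
    rw [e]
    simp only [Ex]
    refine Finset.sum_congr rfl fun q _ => ?_
    rw [ih, show u + 1 + m = u + (m + 1) by omega]

lemma Ex_congr (Q : ℕ) (f : ℕ → ℕ → ℕ → ℝ) (n : ℕ) (G H : (ℕ → ℕ) → ℝ) :
    ∀ (u : ℕ) (p : ℕ → ℕ),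
      (∀ p' : ℕ → ℕ, (∀ v, (v < u ∨ u + n ≤ v) → p' v = p v) → G p' = H p') →
      Ex Q f u n G p = Ex Q f u n H p := by
  induction n with
  | zero => intro u p h; exact h p fun _ _ => rfl
  | succ n ih =>
    intro u p h
    simp only [Ex]
    refine Finset.sum_congr rfl fun q _ => ?_
    congr 1
    refine ih _ _ fun p' hp' => h p' fun v hv => ?_
    rw [hp' v (by omega), Function.update_of_ne (by omega)]

lemma Ex_lin (Q : ℕ) (f : ℕ → ℕ → ℕ → ℝ) (hf : ∀ u a, ∑ q ∈ Finset.Icc 1 Q, f u a q = 1)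
    (n : ℕ) (a b : ℝ) (G : (ℕ → ℕ) → ℝ) :
    ∀ (u : ℕ) (p : ℕ → ℕ), Ex Q f u n (fun p => a + b * G p) p = a + b * Ex Q f u n G p := by
  induction n with
  | zero => intro u p; rfl
  | succ n ih =>
    intro u p
    simp only [Ex, ih]
    simp only [mul_add, Finset.sum_add_distrib, ← Finset.sum_mul, hf, Finset.mul_sum]
    rw [one_mul]
    congr 1
    refine Finset.sum_congr rfl fun q _ => by ring

lemma Ex_const (Q : ℕ) (f : ℕ → ℕ → ℕ → ℝ) (hf : ∀ u a, ∑ q ∈ Finset.Icc 1 Q, f u a q = 1)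
    (n : ℕ) (a : ℝ) (u : ℕ) (p : ℕ → ℕ) : Ex Q f u n (fun _ => a) p = a := by
  have := Ex_lin Q f hf n a 0 (fun _ => 0) u p
  simpa using this

/-- Markov property. -/
lemma Ex_markov (Q : ℕ) (f : ℕ → ℕ → ℕ → ℝ) (n : ℕ) (G : (ℕ → ℕ) → ℝ) :
    ∀ (u : ℕ) (p p' : ℕ → ℕ),
      (∀ p p' : ℕ → ℕ, (∀ v, u + n ≤ v + 1 → p v = p' v) → G p = G p') →
      (∀ v, u ≤ v + 1 → p v = p' v) → 1 ≤ u →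
      Ex Q f u n G p = Ex Q f u n G p' := by
  induction n with
  | zero => intro u p p' hG h _; exact hG p p' h
  | succ n ih =>
    intro u p p' hG h hu
    simp only [Ex]
    refine Finset.sum_congr rfl fun q _ => ?_
    rw [h (u - 1) (by omega)]
    congr 1
    refine ih _ _ _ (fun p p' hh => hG p p' fun v hv => hh v (by omega)) (fun v hv => ?_)
      (by omega)
    by_cases hvu : v = u
    · subst hvu; simp
    · rw [Function.update_of_ne hvu, Function.update_of_ne hvu, h v (by omega)]

/-- Splicing a finite block into a path. -/
def splice (u n : ℕ) (p : ℕ → ℕ) (y : Fin n → ℕ) : ℕ → ℕ :=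
  fun v => if h : u ≤ v ∧ v < u + n then y ⟨v - u, by omega⟩ else p v

lemma splice_cons (u n : ℕ) (p : ℕ → ℕ) (q : ℕ) (y : Fin n → ℕ) :
    splice u (n + 1) p (Fin.cons q y) = splice (u + 1) n (Function.update p u q) y := by
  funext v
  unfold splice
  by_cases h1 : v = u
  · subst h1
    simp
  · by_cases h2 : u + 1 ≤ v ∧ v < u + 1 + n
    · rw [dif_pos (by omega), dif_pos h2]
      have : (⟨v - u, by omega⟩ : Fin (n + 1)) = Fin.succ ⟨v - (u + 1), by omega⟩ := by
        ext; simp; omega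
      rw [this, Fin.cons_succ]
    · rw [dif_neg (by omega), dif_neg h2, Function.update_of_ne h1]

lemma sum_eq_Ex (Q : ℕ) (f : ℕ → ℕ → ℕ → ℝ) (n : ℕ) (G : (ℕ → ℕ) → ℝ) :
    ∀ (u : ℕ) (p : ℕ → ℕ), 1 ≤ u →
      ∑ y ∈ Fintype.piFinset (fun _ : Fin n => Finset.Icc 1 Q),
        G (splice u n p y) * ∏ v ∈ Finset.Ico u (u + n),
          f v (splice u n p y (v - 1)) (splice u n p y v) = Ex Q f u n G p := by
  induction n with
  | zero =>
    intro u p hu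
    have : splice u 0 p (fun i => i.elim0) = p := by
      funext v; unfold splice; rw [dif_neg (by omega)]
    simp only [Ex, Nat.add_zero, Finset.Ico_self, Finset.prod_empty, mul_one]
    rw [Fintype.piFinset_of_isEmpty]
    rw [Fintype.sum_unique]
    congr 1
  | succ n ih =>
    intro u p hu
    simp only [Ex]
    rw [← Finset.sum_congr rfl fun q _ =>
      congrArg (f u (p (u - 1)) q * ·) (ih (u + 1) (Function.update p u q) (by omega))]
    simp only [Finset.mul_sum]
    rw [← Finset.sum_product']
    symm
    refine Finset.sum_bij' (fun a _ => Fin.cons a.1 a.2) (fun y _ => (y 0, Fin.tail y))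
      ?_ ?_ ?_ ?_ ?_
    · rintro ⟨q, y⟩ h
      simp only [Finset.mem_product, Fintype.mem_piFinset] at h ⊢
      intro i
      refine Fin.cases ?_ (fun j => ?_) i
      · simpa using h.1
      · simpa using h.2 j
    · intro y h
      simp only [Finset.mem_product, Fintype.mem_piFinset] at h ⊢
      exact ⟨h 0, fun i => h i.succ⟩
    · rintro ⟨q, y⟩ h
      simp
    · intro y h
      simp
    · rintro ⟨q, y⟩ h
      simp only [splice_cons]
      rw [Finset.prod_eq_prod_Ico_succ_bot (by omega : u < u + (n + 1))]
      rw [show u + 1 + n = u + (n + 1) by omega]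
      have h1 : splice (u + 1) n (Function.update p u q) y u = q := by
        unfold splice; rw [dif_neg (by omega)]; simp
      have h2 : splice (u + 1) n (Function.update p u q) y (u - 1) = p (u - 1) := by
        unfold splice; rw [dif_neg (by omega), Function.update_of_ne (by omega)]
      rw [h1, h2]; ring

lemma catProb_cum (Q : ℕ) (lam : ℕ → ℝ) (ζ : ℝ) (k : ℕ) (h1 : 1 ≤ k) (hk : k < Q) :
    ∑ q ∈ Finset.Icc 1 k, catProb Q lam ζ q = 1 - Lam (ζ - lam k) := by
  induction k, h1 using Nat.le_induction with
  | base => simp [catProb, show (1 : ℕ) ≠ Q by omega]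
  | succ k h1 ih =>
    rw [Finset.sum_Icc_succ_top (by omega), ih (by omega)]
    simp [catProb, show k ≠ 0 by omega, show k + 1 ≠ Q by omega]

lemma catProb_sum (Q : ℕ) (hQ : 2 ≤ Q) (lam : ℕ → ℝ) (ζ : ℝ) :
    ∑ q ∈ Finset.Icc 1 Q, catProb Q lam ζ q = 1 := by
  obtain ⟨k, rfl⟩ : ∃ k, Q = k + 1 := ⟨Q - 1, by omega⟩
  rw [Finset.sum_Icc_succ_top (by omega), catProb_cum _ _ _ _ (by omega) (by omega)]
  simp [catProb, show k ≠ 0 by omega]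

lemma catProb_split (Q : ℕ) (hQ : 2 ≤ Q) (lam : ℕ → ℝ) (ζ : ℝ) (k : ℕ) (h1 : 1 ≤ k)
    (hk : k < Q) (F : ℕ → ℝ) (A B : ℝ) (hA : ∀ q, 1 ≤ q → q ≤ k → F q = A)
    (hB : ∀ q, k < q → q ≤ Q → F q = B) :
    ∑ q ∈ Finset.Icc 1 Q, catProb Q lam ζ q * F q
      = (1 - Lam (ζ - lam k)) * A + Lam (ζ - lam k) * B := by
  have e : ∑ q ∈ Finset.Icc 1 Q, catProb Q lam ζ q * F q
      = ∑ q ∈ Finset.Icc 1 Q, catProb Q lam ζ q * B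
        + ∑ q ∈ Finset.Icc 1 k, catProb Q lam ζ q * (A - B) := by
    have hs : Finset.Icc 1 k ⊆ Finset.Icc 1 Q := Finset.Icc_subset_Icc_right hk.le
    rw [← Finset.sum_sdiff hs, ← Finset.sum_sdiff hs, add_assoc, ← Finset.sum_add_distrib]
    congr 1
    · refine Finset.sum_congr rfl fun q hq => ?_
      simp only [Finset.mem_sdiff, Finset.mem_Icc] at hq
      rw [hB q (by omega) (by omega)]
    · refine Finset.sum_congr rfl fun q hq => ?_
      simp only [Finset.mem_Icc] at hq
      rw [hA q hq.1 hq.2]; ring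
  rw [e, ← Finset.sum_mul, ← Finset.sum_mul, catProb_sum Q hQ, catProb_cum Q lam ζ k h1 hk]
  ring

/-- The moment function. -/
noncomputable def mfun (Q : ℕ) {K : ℕ} (β : Fin K → ℝ) (γ lam : ℕ → ℝ)
    (x : ℕ → Fin K → ℝ) (q1 q3 t s r : ℕ) (p : ℕ → ℕ) : ℝ :=
  let z := zidx β γ x p
  if p t ≤ q1 ∧ p s = Q ∧ p r ≤ q3 then
    Real.exp (z t - z s + (lam (Q - 1) - lam q1))
  else if p t ≤ q1 ∧ p s = Q ∧ q3 < p r then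
    Real.exp (z t - z r + (lam q3 - lam q1))
  else if q1 < p t ∧ p s < Q then -1
  else if q1 < p t ∧ p s = Q ∧ p r ≤ q3 then
    Real.exp (z r - z s + (lam (Q - 1) - lam q3)) - 1
  else 0

/-- The kernel. -/
noncomputable def ker (Q : ℕ) {K : ℕ} (β : Fin K → ℝ) (γ lam : ℕ → ℝ)
    (x : ℕ → Fin K → ℝ) (α : ℝ) (u a b : ℕ) : ℝ :=
  catProb Q lam ((∑ k, x u k * β k) + γ a + α) b

lemma zidx_congr {K : ℕ} (β : Fin K → ℝ) (γ : ℕ → ℝ) (x : ℕ → Fin K → ℝ) (p p' : ℕ → ℕ)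
    (u : ℕ) (h : p (u - 1) = p' (u - 1)) : zidx β γ x p u = zidx β γ x p' u := by
  simp [zidx, h]

lemma ker_zidx (Q : ℕ) {K : ℕ} (β : Fin K → ℝ) (γ lam : ℕ → ℝ)
    (x : ℕ → Fin K → ℝ) (α : ℝ) (u : ℕ) (p : ℕ → ℕ) (b : ℕ) :
    ker Q β γ lam x α u (p (u - 1)) b = catProb Q lam (zidx β γ x p u + α) b := rfl

/-- Expectation of the moment function given `y_1, …, y_{r-1}`. -/
noncomputable def m2 (Q : ℕ) {K : ℕ} (β : Fin K → ℝ) (γ lam : ℕ → ℝ)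
    (x : ℕ → Fin K → ℝ) (α : ℝ) (q1 t s : ℕ) (B : (ℕ → ℕ) → ℝ) (p : ℕ → ℕ) : ℝ :=
  if p s = Q then
    if p t ≤ q1 then
      Real.exp (zidx β γ x p t + α - lam q1)
        * (1 + Real.exp (-(zidx β γ x p s + α - lam (Q - 1)))) * B p
    else Real.exp (-(zidx β γ x p s + α - lam (Q - 1))) * (1 - B p) - B p
  else if p t ≤ q1 then 0 else -1

lemma Lam_mul (u : ℝ) : Lam u * (1 + Real.exp (-u)) = 1 := by
  unfold Lam
  have : (1 + Real.exp (-u)) ≠ 0 := by positivity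
  field_simp

lemma Lam_exp (u : ℝ) : 1 - Lam u = Real.exp (-u) * Lam u := by
  linarith [Lam_mul u]

lemma Lam_exp' (u : ℝ) : Real.exp u * (1 - Lam u) = Lam u := by
  rw [Lam_exp, ← mul_assoc, ← Real.exp_add]; simp

section core
variable (Q K : ℕ) (hQ : 2 ≤ Q) (β : Fin K → ℝ) (γ lam : ℕ → ℝ)
    (q1 q3 : ℕ) (hq1 : 1 ≤ q1) (hq1' : q1 < Q) (hq3 : 1 ≤ q3) (hq3' : q3 < Q)
    (x : ℕ → Fin K → ℝ) (α : ℝ)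

lemma step_r (hQ : 2 ≤ Q) (hq3 : 1 ≤ q3) (hq3' : q3 < Q) (t s r : ℕ) (hts : t < s) (hsr : s < r) (p : ℕ → ℕ) (hps : p s ≤ Q) :
    Ex Q (ker Q β γ lam x α) r 1 (mfun Q β γ lam x q1 q3 t s r) p
      = m2 Q β γ lam x α q1 t s (fun p => 1 - Lam (zidx β γ x p r + α - lam q3)) p := by
  rw [Ex_one]
  simp only [ker_zidx]
  have hz : ∀ q u, u ≤ r → zidx β γ x (Function.update p r q) u = zidx β γ x p u ∨ r = 0 := by
    intro q u hu
    by_cases hr : r = 0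
    · exact Or.inr hr
    · left; apply zidx_congr; rw [Function.update_of_ne (by omega)]
  have hz : ∀ q u, u ≤ r → zidx β γ x (Function.update p r q) u = zidx β γ x p u :=
    fun q u hu => (hz q u hu).resolve_right (by omega)
  have hM : ∀ q, mfun Q β γ lam x q1 q3 t s r (Function.update p r q) =
      if p t ≤ q1 ∧ p s = Q ∧ q ≤ q3 then
        Real.exp (zidx β γ x p t - zidx β γ x p s + (lam (Q - 1) - lam q1))
      else if p t ≤ q1 ∧ p s = Q ∧ q3 < q then
        Real.exp (zidx β γ x p t - zidx β γ x p r + (lam q3 - lam q1))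
      else if q1 < p t ∧ p s < Q then -1
      else if q1 < p t ∧ p s = Q ∧ q ≤ q3 then
        Real.exp (zidx β γ x p r - zidx β γ x p s + (lam (Q - 1) - lam q3)) - 1
      else 0 := by
    intro q
    simp only [mfun]
    rw [hz q t (by omega), hz q s (by omega), hz q r le_rfl, Function.update_self,
      Function.update_of_ne (by omega : t ≠ r), Function.update_of_ne (by omega : s ≠ r)]
  simp only [hM]
  unfold m2
  set zt := zidx β γ x p t
  set zs := zidx β γ x p s
  set zr := zidx β γ x p r
  by_cases h1 : p s = Q
  · by_cases h2 : p t ≤ q1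
    · rw [if_pos h1, if_pos h2]
      rw [catProb_split Q hQ lam _ q3 hq3 hq3' _
        (Real.exp (zt - zs + (lam (Q - 1) - lam q1))) (Real.exp (zt - zr + (lam q3 - lam q1)))]
      · have e1 : Real.exp (zt - zs + (lam (Q - 1) - lam q1))
          = Real.exp (zt + α - lam q1) * Real.exp (-(zs + α - lam (Q - 1))) := by
          rw [← Real.exp_add]; congr 1; ring
        have e2 : Real.exp (zt - zr + (lam q3 - lam q1))
          = Real.exp (zt + α - lam q1) * Real.exp (-(zr + α - lam q3)) := by
          rw [← Real.exp_add]; congr 1; ring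
        rw [e1, e2]
        linear_combination (-Real.exp (zt + α - lam q1)) * Lam_exp (zr + α - lam q3)
      · intro q _ hq; rw [if_pos ⟨h2, h1, hq⟩]
      · intro q hq _; rw [if_neg (by omega), if_pos ⟨h2, h1, hq⟩]
    · rw [if_pos h1, if_neg h2]
      rw [catProb_split Q hQ lam _ q3 hq3 hq3' _
        (Real.exp (zr - zs + (lam (Q - 1) - lam q3)) - 1) 0]
      · have e1 : Real.exp (zr - zs + (lam (Q - 1) - lam q3))
          = Real.exp (-(zs + α - lam (Q - 1))) * Real.exp (zr + α - lam q3) := by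
          rw [← Real.exp_add]; congr 1; ring
        rw [e1]
        linear_combination Real.exp (-(zs + α - lam (Q - 1))) * Lam_exp' (zr + α - lam q3)
      · intro q _ hq
        rw [if_neg (by omega), if_neg (by omega), if_neg (by omega), if_pos (by omega)]
      · intro q hq _
        rw [if_neg (by omega), if_neg (by omega), if_neg (by omega), if_neg (by omega)]
  · rw [if_neg h1]
    by_cases h2 : p t ≤ q1
    · rw [if_pos h2]
      refine Finset.sum_eq_zero fun q _ => ?_
      rw [if_neg (by omega), if_neg (by omega), if_neg (by omega), if_neg (by omega), mul_zero]
    · rw [if_neg h2]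
      rw [catProb_split Q hQ lam _ q3 hq3 hq3' _ (-1) (-1)]
      · ring
      · intro q _ hq
        rw [if_neg (by omega), if_neg (by omega), if_pos (by omega)]
      · intro q _ hq
        rw [if_neg (by omega), if_neg (by omega), if_pos (by omega)]

lemma step_mid (hQ : 2 ≤ Q) (t s c : ℕ) (hts : t < s) (B : (ℕ → ℕ) → ℝ) (p : ℕ → ℕ) :
    Ex Q (ker Q β γ lam x α) (s + 1) c (m2 Q β γ lam x α q1 t s B) p
      = m2 Q β γ lam x α q1 t s (Ex Q (ker Q β γ lam x α) (s + 1) c B) p := by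
  have hf : ∀ u a, ∑ q ∈ Finset.Icc 1 Q, ker Q β γ lam x α u a q = 1 :=
    fun u a => catProb_sum Q hQ lam _
  have key : ∀ a b : ℝ, (∀ B : (ℕ → ℕ) → ℝ, ∀ p' : ℕ → ℕ,
      (∀ v, (v < s + 1 ∨ s + 1 + c ≤ v) → p' v = p v) →
      m2 Q β γ lam x α q1 t s B p' = a + b * B p') →
      Ex Q (ker Q β γ lam x α) (s + 1) c (m2 Q β γ lam x α q1 t s B) p
      = m2 Q β γ lam x α q1 t s (Ex Q (ker Q β γ lam x α) (s + 1) c B) p := by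
    intro a b h
    rw [h _ p fun _ _ => rfl, ← Ex_lin Q _ hf]
    exact Ex_congr _ _ _ _ _ _ _ (h B)
  have hz : ∀ p' : ℕ → ℕ, (∀ v, (v < s + 1 ∨ s + 1 + c ≤ v) → p' v = p v) →
      p' t = p t ∧ p' s = p s ∧ zidx β γ x p' t = zidx β γ x p t ∧
      zidx β γ x p' s = zidx β γ x p s := fun p' h =>
    ⟨h _ (by omega), h _ (by omega), zidx_congr _ _ _ _ _ _ (h _ (by omega)),
      zidx_congr _ _ _ _ _ _ (h _ (by omega))⟩
  by_cases h1 : p s = Q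
  · by_cases h2 : p t ≤ q1
    · refine key 0 (Real.exp (zidx β γ x p t + α - lam q1)
        * (1 + Real.exp (-(zidx β γ x p s + α - lam (Q - 1))))) fun B p' h => ?_
      obtain ⟨e1, e2, e3, e4⟩ := hz p' h
      unfold m2
      rw [e1, e2, e3, e4, if_pos h1, if_pos h2]; ring
    · refine key (Real.exp (-(zidx β γ x p s + α - lam (Q - 1))))
        (-(Real.exp (-(zidx β γ x p s + α - lam (Q - 1)))) - 1) fun B p' h => ?_
      obtain ⟨e1, e2, e3, e4⟩ := hz p' h
      unfold m2
      rw [e1, e2, e4, if_pos h1, if_neg h2]; ring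
  · refine key (if p t ≤ q1 then 0 else -1) 0 fun B p' h => ?_
    obtain ⟨e1, e2, e3, e4⟩ := hz p' h
    unfold m2
    rw [e1, e2, if_neg h1]; ring

lemma step_s (hQ : 2 ≤ Q) (t s : ℕ) (hts : t < s) (B : (ℕ → ℕ) → ℝ) (p : ℕ → ℕ) (c : ℝ)
    (hc : B (Function.update p s Q) = c) :
    Ex Q (ker Q β γ lam x α) s 1 (m2 Q β γ lam x α q1 t s B) p
      = if p t ≤ q1 then Real.exp (zidx β γ x p t + α - lam q1) * c else -c := by
  rw [Ex_one]
  simp only [ker_zidx]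
  have hz : ∀ q u, u ≤ s → zidx β γ x (Function.update p s q) u = zidx β γ x p u := by
    intro q u hu
    apply zidx_congr; rw [Function.update_of_ne (by omega)]
  rw [catProb_split Q hQ lam _ (Q - 1) (by omega) (by omega) _
    (if p t ≤ q1 then 0 else -1) (m2 Q β γ lam x α q1 t s B (Function.update p s Q))]
  · unfold m2
    rw [hz _ _ le_rfl, hz _ _ hts.le, Function.update_self, if_pos rfl,
      Function.update_of_ne hts.ne, hc]
    set a := zidx β γ x p s + α - lam (Q - 1)
    split_ifs
    · linear_combination Real.exp (zidx β γ x p t + α - lam q1) * c * Lam_mul a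
    · linear_combination (-1 : ℝ) * Lam_exp a - c * Lam_mul a + Lam_exp a - Lam_exp a
  · intro q _ hq
    unfold m2
    rw [Function.update_self, if_neg (by omega), Function.update_of_ne hts.ne]
  · intro q hq hq'
    rw [show q = Q by omega]

lemma core (hQ : 2 ≤ Q) (hq1 : 1 ≤ q1) (hq1' : q1 < Q) (hq3 : 1 ≤ q3) (hq3' : q3 < Q)
    (t s r b c d : ℕ) (ht : 1 ≤ t) (hs : s = t + 1 + b) (hr : r = s + 1 + c) (p0 : ℕ → ℕ) :
    Ex Q (ker Q β γ lam x α) t (1 + (b + (1 + (c + (1 + d)))))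
      (mfun Q β γ lam x q1 q3 t s r) p0 = 0 := by
  have hf : ∀ u a, ∑ q ∈ Finset.Icc 1 Q, ker Q β γ lam x α u a q = 1 :=
    fun u a => catProb_sum Q hQ lam _
  set f := ker Q β γ lam x α with hfdef
  set B : (ℕ → ℕ) → ℝ := fun p => 1 - Lam (zidx β γ x p r + α - lam q3) with hB
  have A1 : ∀ p, Ex Q f (r + 1) d (mfun Q β γ lam x q1 q3 t s r) p
      = mfun Q β γ lam x q1 q3 t s r p := by
    intro p
    refine Eq.trans (Ex_congr Q f d _ (fun _ => mfun Q β γ lam x q1 q3 t s r p) _ _ ?_)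
      (Ex_const Q f hf _ _ _ _)
    intro p' h
    simp only [mfun]
    rw [h t (by omega), h s (by omega), h r (by omega),
      zidx_congr β γ x p' p t (h _ (by omega)), zidx_congr β γ x p' p s (h _ (by omega)),
      zidx_congr β γ x p' p r (h _ (by omega))]
  have A1' := funext A1
  rw [Ex_add, Ex_one]
  set C := Ex Q f (s + 1) c B (Function.update p0 s Q) with hC
  -- value after integrating out everything after period t
  have A2 : ∀ p : ℕ → ℕ, (∀ v, t < v → p v = p0 v) →
      Ex Q f (t + 1) (b + (1 + (c + (1 + d)))) (mfun Q β γ lam x q1 q3 t s r) p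
      = if p t ≤ q1 then Real.exp (zidx β γ x p t + α - lam q1) * C else -C := by
    intro p hp
    rw [Ex_add, ← hs]
    refine Eq.trans (Ex_congr Q f b _ (fun _ =>
      if p t ≤ q1 then Real.exp (zidx β γ x p t + α - lam q1) * C else -C) _ _ ?_)
      (Ex_const Q f hf _ _ _ _)
    intro p' hp'
    rw [Ex_add]
    have e : Ex Q f s 1 (Ex Q f (s + 1) (c + (1 + d)) (mfun Q β γ lam x q1 q3 t s r)) p'
        = Ex Q f s 1 (m2 Q β γ lam x α q1 t s (Ex Q f (s + 1) c B)) p' := by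
      rw [Ex_one, Ex_one]
      refine Finset.sum_congr rfl fun q hq => ?_
      congr 1
      rw [← step_mid Q K β γ lam q1 x α hQ t s c (by omega), Ex_add, ← hr]
      refine Ex_congr _ _ _ _ _ _ _ fun p'' hp'' => ?_
      rw [Ex_add, A1']
      refine step_r Q K β γ lam q1 q3 x α hQ hq3 hq3' t s r (by omega) (by omega) _ ?_
      rw [hp'' s (by omega), Function.update_self]
      exact (Finset.mem_Icc.mp hq).2
    rw [e, step_s Q K β γ lam q1 x α hQ t s (by omega) _ p' C ?_]
    · rw [hp' t (by omega), zidx_congr β γ x p' p t (hp' _ (by omega))]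
    · refine Ex_markov Q f c B (s + 1) _ _ ?_ ?_ (by omega)
      · intro p p' h
        simp only [hB]
        rw [zidx_congr β γ x p p' r (h _ (by omega))]
      · intro v hv
        by_cases hvs : v = s
        · subst hvs; simp
        · rw [Function.update_of_ne hvs, Function.update_of_ne hvs, hp' v (by omega),
            hp v (by omega)]
  have A3 : ∀ q, Ex Q f (t + 1) (b + (1 + (c + (1 + d)))) (mfun Q β γ lam x q1 q3 t s r)
      (Function.update p0 t q)
      = if q ≤ q1 then Real.exp (zidx β γ x p0 t + α - lam q1) * C else -C := by
    intro q
    rw [A2 _ fun v hv => Function.update_of_ne (by omega) _ _, Function.update_self,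
      zidx_congr β γ x (Function.update p0 t q) p0 t (Function.update_of_ne (by omega) _ _)]
  simp only [A3]
  simp only [hfdef, ker_zidx]
  rw [catProb_split Q hQ lam _ q1 hq1 hq1' _
    (Real.exp (zidx β γ x p0 t + α - lam q1) * C) (-C)]
  · linear_combination C * Lam_exp' (zidx β γ x p0 t + α - lam q1)
  · intro q _ hq; rw [if_pos hq]
  · intro q hq _; rw [if_neg (by omega)]

end core

theorem statement5 (Q K T : ℕ) (hQ : 2 ≤ Q) (hK : 1 ≤ K) (hT : 3 ≤ T)
    (β : Fin K → ℝ) (γ lam : ℕ → ℝ)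
    (hlam : ∀ q r : ℕ, 1 ≤ q → q < r → r ≤ Q - 1 → lam q < lam r)
    (y0 : ℕ) (hy0 : y0 ∈ Finset.Icc 1 Q)
    (q1 q3 : ℕ) (hq1 : q1 ∈ Finset.Icc 1 (Q - 1)) (hq3 : q3 ∈ Finset.Icc 1 (Q - 1))
    (t s r : ℕ) (ht : 1 ≤ t) (hts : t < s) (hsr : s < r) (hr : r ≤ T)
    (x : ℕ → Fin K → ℝ) (w : (Fin (t - 1) → ℕ) → ℝ) (α : ℝ) :
    (∑ y ∈ Fintype.piFinset (fun _ : Fin T => Finset.Icc 1 Q),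
      w (fun i => fullPath T y0 y (i.val + 1)) *
      (let p := fullPath T y0 y
       let z := zidx β γ x p
       if p t ≤ q1 ∧ p s = Q ∧ p r ≤ q3 then
          Real.exp (z t - z s + (lam (Q - 1) - lam q1))
        else if p t ≤ q1 ∧ p s = Q ∧ q3 < p r then
          Real.exp (z t - z r + (lam q3 - lam q1))
        else if q1 < p t ∧ p s < Q then -1
        else if q1 < p t ∧ p s = Q ∧ p r ≤ q3 then
          Real.exp (z r - z s + (lam (Q - 1) - lam q3)) - 1
        else 0) *
      pathProb Q T β γ lam x α (fullPath T y0 y)) = 0 := by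
  rw [Finset.mem_Icc] at hq1 hq3
  have hfp : ∀ y : Fin T → ℕ, fullPath T y0 y = splice 1 T (fun _ => y0) y := by
    intro y
    funext v
    unfold fullPath splice
    by_cases h : 1 ≤ v ∧ v ≤ T
    · rw [dif_pos h, dif_pos (by omega)]
    · rw [dif_neg h, dif_neg (by omega)]
  have hf : ∀ u a, ∑ q ∈ Finset.Icc 1 Q, ker Q β γ lam x α u a q = 1 :=
    fun u a => catProb_sum Q hQ lam _
  have main := sum_eq_Ex Q (ker Q β γ lam x α) T
    (fun p => w (fun i => p (i.val + 1)) * mfun Q β γ lam x q1 q3 t s r p) 1 (fun _ => y0) le_rfl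
  have hzero : Ex Q (ker Q β γ lam x α) 1 T
      (fun p => w (fun i => p (i.val + 1)) * mfun Q β γ lam x q1 q3 t s r p) (fun _ => y0)
      = 0 := by
    have hT' : T = (t - 1) + (1 + ((s - t - 1) + (1 + ((r - s - 1) + (1 + (T - r)))))) := by
      omega
    rw [hT', Ex_add, show 1 + (t - 1) = t by omega]
    refine Eq.trans (Ex_congr _ _ _ _ (fun _ => 0) _ _ ?_) (Ex_const _ _ hf _ _ _ _)
    intro p' _
    refine Eq.trans (Ex_congr _ _ _ _ (fun p => 0 + w (fun i => p' (i.val + 1)) *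
      mfun Q β γ lam x q1 q3 t s r p) _ _ ?_) ?_
    · intro p hp
      have : (fun i : Fin (t - 1) => p (i.val + 1)) = fun i => p' (i.val + 1) := by
        funext i
        exact hp _ (by omega)
      simp only [this, zero_add]
    · rw [Ex_lin _ _ hf, core Q K β γ lam q1 q3 x α hQ hq1.1 (by omega) hq3.1 (by omega) t s r
        _ _ _ ht (by omega) (by omega)]
      simp
  refine Eq.trans ?_ (main.trans hzero)
  refine Finset.sum_congr rfl fun y _ => ?_
  rw [← hfp, show Finset.Ico 1 (1 + T) = Finset.Icc 1 T by ext; simp; omega]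
  rfl
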